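/- Let F be a totally real number field of degree m with ring of integers O. Then there exists a totally positive element α ∈ F such that the set of minimal vectors of the scaled trace form φ_α contains m elements of O that are linearly independent over ℚ (equivalently, that span F as a ℚ-vector space). -/

import Mathlib

open NumberField

/-- The scaled trace form `φ_α : 𝓞 F → ℚ`, `φ_α(η) = Tr_{F/ℚ}(α η²)`. -/
noncomputable def scaledTraceForm (F : Type*) [Field F] [NumberField F] (α : F)
    (η : RingOfIntegers F) : ℚ :=
  Algebra.trace ℚ F (α * (η : F) * (η : F))

/-- `η` is a minimal vector for the scaled trace form `φ_α`: it is nonzero and attains the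
minimum of `φ_α` on `𝓞 F ∖ {0}`. -/
def IsMinVec (F : Type*) [Field F] [NumberField F] (α : F) (η : RingOfIntegers F) : Prop :=
  η ≠ 0 ∧ ∀ ξ : RingOfIntegers F, ξ ≠ 0 → scaledTraceForm F α η ≤ scaledTraceForm F α ξ


open Module in
theorem aux_periodic_span {ι : Type*} [Fintype ι] (b : Basis ι ℝ (ι → ℝ)) {β : Type*}
    (h : (ι → ℝ) → β) (hb : ∀ i x, h (x + b i) = h x)
    (v : ι → ℝ) (hv : v ∈ Submodule.span ℤ (Set.range b)) : ∀ x, h (x + v) = h x := by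
  induction hv using Submodule.span_induction with
  | mem v hv => obtain ⟨i, rfl⟩ := hv; exact hb i
  | zero => simp
  | add v w _ _ h1 h2 => intro x; rw [← add_assoc, h2, h1]
  | smul a v _ hv =>
    have hneg : ∀ x, h (x + -v) = h x := fun x => by
      have := hv (x + -v); rw [← this]; simp
    intro x
    induction a using Int.induction_on generalizing x with
    | zero => simp
    | succ n ih => rw [add_smul, one_smul, ← add_assoc, hv, ih]
    | pred n ih => rw [sub_smul, one_smul, sub_eq_add_neg, ← add_assoc, hneg, ih]

open Module in
theorem aux_periodic_min {ι : Type*} [Fintype ι] (b : Basis ι ℝ (ι → ℝ))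
    (h : (ι → ℝ) → ℝ) (hc : Continuous h) (hb : ∀ i x, h (x + b i) = h x) :
    ∃ x₀, ∀ x, h x₀ ≤ h x := by
  have hbd := ZSpan.fundamentalDomain_isBounded b
  have hK : IsCompact (closure (ZSpan.fundamentalDomain b)) := hbd.isCompact_closure
  obtain ⟨x₀, _, hx₀⟩ := hK.exists_isMinOn
    ⟨ZSpan.fract b 0, subset_closure (ZSpan.fract_mem_fundamentalDomain b 0)⟩ hc.continuousOn
  refine ⟨x₀, fun x => ?_⟩
  have h1 : h (ZSpan.fract b x) = h x := by
    rw [ZSpan.fract_apply, sub_eq_add_neg]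
    exact aux_periodic_span b h hb _ (neg_mem (ZSpan.floor b x).2) x
  rw [← h1]
  exact hx₀ (subset_closure (ZSpan.fract_mem_fundamentalDomain b x))

theorem aux_lagrange {ι : Type*} [Fintype ι] (δ : ℝ) (hδ : 0 < δ) :
    ∃ (n : ℕ) (t c : Fin n → ℝ), (∀ i, 0 < t i ∧ t i ≤ δ) ∧ ∑ i, c i = 1 ∧
      ∀ A : (ι → ℝ) →L[ℝ] (ι → ℝ),
        (ContinuousLinearMap.id ℝ (ι → ℝ) + A).det =
          ∑ i, c i * (ContinuousLinearMap.id ℝ (ι → ℝ) + t i • A).det := by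
  classical
  let n := Fintype.card ι + 1
  let t : Fin n → ℝ := fun i => δ / ((i : ℕ) + 1)
  have hinj : Set.InjOn t (Finset.univ : Finset (Fin n)) := by
    intro i _ j _ hij
    have h1 : ((i : ℕ) : ℝ) + 1 ≠ 0 := by positivity
    have h2 : ((j : ℕ) : ℝ) + 1 ≠ 0 := by positivity
    simp only [t] at hij
    field_simp at hij
    have : ((i : ℕ) : ℝ) = (j : ℕ) := by linarith
    exact Fin.ext (by exact_mod_cast this)
  refine ⟨n, t, fun i => (Lagrange.basis Finset.univ t i).eval 1, fun i => ⟨by positivity, ?_⟩, ?_, ?_⟩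
  · apply div_le_self hδ.le; simp
  · have := Lagrange.sum_basis hinj (Finset.univ_nonempty)
    rw [← Polynomial.eval_finsetSum, this]; simp
  · intro A
    let M := LinearMap.toMatrix' (A : (ι → ℝ) →ₗ[ℝ] (ι → ℝ))
    let p : Polynomial ℝ := Matrix.det ((Polynomial.X : Polynomial ℝ) • M.map Polynomial.C + (1 : Matrix ι ι ℝ).map Polynomial.C)
    have hdeg : p.degree < (Finset.univ : Finset (Fin n)).card := by
      refine lt_of_le_of_lt Polynomial.degree_le_natDegree ?_
      have := Polynomial.natDegree_det_X_add_C_le M 1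
      rw [Finset.card_univ, Fintype.card_fin]
      exact_mod_cast Nat.lt_succ_of_le this
    have hev : ∀ s : ℝ, p.eval s = (ContinuousLinearMap.id ℝ (ι → ℝ) + s • A).det := by
      intro s
      rw [ContinuousLinearMap.det, ← LinearMap.det_toMatrix']
      simp only [p]
      rw [← Polynomial.coe_evalRingHom, RingHom.map_det]
      congr 1
      ext i j
      simp [M, LinearMap.toMatrix'_apply, Matrix.one_apply, Pi.single_apply, add_comm]
      split_ifs <;> simp [mul_comm]
    have h1 := Lagrange.eq_interpolate hinj hdeg
    have h2 := hev 1
    rw [one_smul] at h2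
    rw [← h2, h1, Lagrange.interpolate_apply, Polynomial.eval_finsetSum]
    refine Finset.sum_congr rfl fun i _ => ?_
    rw [Polynomial.eval_mul, Polynomial.eval_C, hev, mul_comm]

open Module MeasureTheory in
theorem aux_degree {ι : Type*} [Fintype ι] (b : Basis ι ℝ (ι → ℝ))
    (f : (ι → ℝ) → (ι → ℝ)) (hf : ContDiff ℝ 1 f) (hb : ∀ i x, f (x + b i) = f x + b i) :
    ∃ x, (fderiv ℝ f x).det ≠ 0 := by
  classical
  by_contra! hdet
  let g : (ι → ℝ) → (ι → ℝ) := fun x => f x - x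
  have hg : ContDiff ℝ 1 g := hf.sub contDiff_id
  have hgb : ∀ i x, g (x + b i) = g x := fun i x => by simp only [g, hb]; abel
  have hgper := aux_periodic_span b g hgb
  have hg'c : Continuous (fderiv ℝ g) := hg.continuous_fderiv (by norm_num)
  have hgd : Differentiable ℝ g := hg.differentiable (by norm_num)
  have hg'b : ∀ i x, fderiv ℝ g (x + b i) = fderiv ℝ g x := fun i x => by
    rw [← fderiv_comp_add_right]; congr 1; ext1 y; exact hgb i y
  obtain ⟨x₀, hx₀⟩ := aux_periodic_min b (fun x => -‖fderiv ℝ g x‖) (by fun_prop)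
    (fun i x => by simp only [hg'b])
  set C : NNReal := ‖fderiv ℝ g x₀‖₊ with hC
  have hle : ∀ x, ‖fderiv ℝ g x‖₊ ≤ C := fun x => by
    have := hx₀ x
    simp only [neg_le_neg_iff] at this
    exact this
  have hlip : LipschitzWith C g := lipschitzWith_of_nnnorm_fderiv_le hgd hle
  -- positivity of the determinant near the identity
  have hpos : ∀ᶠ B : (ι → ℝ) →L[ℝ] (ι → ℝ) in nhds 0, 0 < (ContinuousLinearMap.id ℝ (ι → ℝ) + B).det := by
    have hcont : Continuous fun B : (ι → ℝ) →L[ℝ] (ι → ℝ) => (ContinuousLinearMap.id ℝ (ι → ℝ) + B).det :=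
      ContinuousLinearMap.continuous_det.comp (by fun_prop)
    have := hcont.tendsto 0
    refine this.eventually (lt_mem_nhds ?_)
    simp [ContinuousLinearMap.det]
  obtain ⟨r, hr, hball⟩ := Metric.eventually_nhds_iff.1 hpos
  obtain ⟨δ, hδ, hδr, hδ1⟩ : ∃ δ : ℝ, 0 < δ ∧ δ * C < r ∧ δ * C < 1 := by
    refine ⟨min r 1 / (2 * (C + 1)), by positivity, ?_, ?_⟩
    all_goals
      have h0 : (0:ℝ) ≤ C := C.2
      rw [div_mul_eq_mul_div, div_lt_iff₀ (by positivity)]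
      have h1 := min_le_left r 1
      have h2 := min_le_right r 1
      have h3 : 0 < min r 1 := by positivity
      nlinarith
  have hvol : ∀ t : ℝ, 0 < t → t ≤ δ →
      ∫ x in ZSpan.fundamentalDomain b, (ContinuousLinearMap.id ℝ (ι → ℝ) + t • fderiv ℝ g x).det
        = volume.real (ZSpan.fundamentalDomain b) := by
    intro t ht htδ
    have htC : t * C < 1 := lt_of_le_of_lt (mul_le_mul_of_nonneg_right htδ C.2) hδ1
    have htr : t * C < r := lt_of_le_of_lt (mul_le_mul_of_nonneg_right htδ C.2) hδr
    let F : (ι → ℝ) → (ι → ℝ) := fun x => x + t • g x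
    have hFper : ∀ v ∈ Submodule.span ℤ (Set.range b), ∀ x, F (x + v) = F x + v := fun v hv x => by
      simp only [F, hgper v hv]; abel
    have hcontr : ∀ y, ContractingWith (Real.toNNReal t * C) (fun x => y - t • g x) := by
      intro y
      refine ⟨by rw [← NNReal.coe_lt_coe, NNReal.coe_mul, Real.coe_toNNReal t ht.le]; exact htC, ?_⟩
      refine LipschitzWith.of_dist_le_mul fun a c => ?_
      rw [dist_sub_left, dist_smul₀]
      have := hlip.dist_le_mul a c
      rw [Real.norm_of_nonneg ht.le]
      rw [NNReal.coe_mul, Real.coe_toNNReal t ht.le, mul_assoc]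
      exact mul_le_mul_of_nonneg_left this ht.le
    have hFbij : Function.Bijective F := by
      constructor
      · intro a c hac
        refine (hcontr (F a)).fixedPoint_unique' (x := a) (y := c) ?_ ?_
        · simp [Function.IsFixedPt, F]
        · rw [hac]; simp [Function.IsFixedPt, F]
      · intro y
        refine ⟨(hcontr y).fixedPoint, ?_⟩
        have := (hcontr y).fixedPoint_isFixedPt
        simp only [Function.IsFixedPt] at this
        simp only [F]
        nth_rewrite 1 [← this]
        simp
    have hFd : ∀ x, HasFDerivAt F (ContinuousLinearMap.id ℝ (ι → ℝ) + t • fderiv ℝ g x) x := fun x =>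
      (hasFDerivAt_id x).add ((hgd x).hasFDerivAt.const_smul t)
    have hFcont : Continuous F := by
      have := hg.continuous
      fun_prop
    have hdom : IsAddFundamentalDomain (Submodule.span ℤ (Set.range b)) (F '' ZSpan.fundamentalDomain b) volume := by
      refine IsAddFundamentalDomain.mk' ?_ ?_
      · exact ((ZSpan.fundamentalDomain_measurableSet b).image_of_continuousOn_injOn
          hFcont.continuousOn hFbij.1.injOn).nullMeasurableSet
      · intro x
        obtain ⟨y, rfl⟩ := hFbij.2 x
        obtain ⟨v, hv, huniq⟩ := ZSpan.exist_unique_vadd_mem_fundamentalDomain b y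
        have key : ∀ w : Submodule.span ℤ (Set.range b), w +ᵥ F y = F (w +ᵥ y) := fun w => by
          rw [Submodule.vadd_def, Submodule.vadd_def, vadd_eq_add, vadd_eq_add, add_comm, ← hFper w.1 w.2, add_comm]
        refine ⟨v, ?_, ?_⟩
        · beta_reduce
          rw [key]; exact ⟨_, hv, rfl⟩
        · intro w hw
          simp only [key] at hw
          exact huniq w ((hFbij.1.mem_set_image).1 hw)
    have : VAddInvariantMeasure (Submodule.span ℤ (Set.range b)) (ι → ℝ) volume :=
      ⟨fun c s _ => measure_preimage_add volume (c : ι → ℝ) s⟩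
    have hmeas := (ZSpan.isAddFundamentalDomain b volume).measure_eq hdom
    have hcv := lintegral_abs_det_fderiv_eq_addHaar_image volume (ZSpan.fundamentalDomain_measurableSet b)
      (fun x _ => (hFd x).hasFDerivWithinAt) hFbij.1.injOn
    rw [← hmeas] at hcv
    have hpos' : ∀ x, 0 < (ContinuousLinearMap.id ℝ (ι → ℝ) + t • fderiv ℝ g x).det := fun x => by
      apply hball
      rw [dist_zero_right, norm_smul, Real.norm_of_nonneg ht.le]
      exact lt_of_le_of_lt (mul_le_mul_of_nonneg_left (hle x) ht.le) htr
    rw [integral_eq_lintegral_of_nonneg_ae]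
    · rw [Measure.real, ← hcv]
      congr 2
      ext1 x
      rw [abs_of_pos (hpos' x)]
    · exact Filter.Eventually.of_forall fun x => (hpos' x).le
    · apply Continuous.aestronglyMeasurable
      exact ContinuousLinearMap.continuous_det.comp (by fun_prop)
  obtain ⟨n, t, c, ht, hc, hA⟩ := aux_lagrange (ι := ι) δ hδ
  have hfg : ∀ x, (ContinuousLinearMap.id ℝ (ι → ℝ) + fderiv ℝ g x).det = 0 := fun x => by
    rw [← hdet x]
    congr 1
    have : f = fun x => x + g x := by ext1 x; simp [g]
    conv_rhs => rw [this]
    exact ((hasFDerivAt_id x).add (hgd x).hasFDerivAt).fderiv.symm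
  have hint : ∀ s : ℝ, IntegrableOn (fun x => (ContinuousLinearMap.id ℝ (ι → ℝ) + s • fderiv ℝ g x).det)
      (ZSpan.fundamentalDomain b) := by
    intro s
    have : Continuous (fun x => (ContinuousLinearMap.id ℝ (ι → ℝ) + s • fderiv ℝ g x).det) :=
      ContinuousLinearMap.continuous_det.comp (by fun_prop)
    exact (this.continuousOn.integrableOn_compact
      (ZSpan.fundamentalDomain_isBounded b).isCompact_closure).mono_set subset_closure
  have h0 : (0 : ℝ) = volume.real (ZSpan.fundamentalDomain b) := by
    calc (0 : ℝ) = ∫ x in ZSpan.fundamentalDomain b, (ContinuousLinearMap.id ℝ (ι → ℝ) + fderiv ℝ g x).det := by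
          simp [hfg]
      _ = ∫ x in ZSpan.fundamentalDomain b, ∑ i, c i * (ContinuousLinearMap.id ℝ (ι → ℝ) + t i • fderiv ℝ g x).det := by
          simp_rw [← hA]
      _ = ∑ i, c i * volume.real (ZSpan.fundamentalDomain b) := by
          rw [integral_finsetSum _ (fun i _ => (hint (t i)).const_mul (c i))]
          refine Finset.sum_congr rfl fun i _ => ?_
          rw [integral_const_mul, hvol _ (ht i).1 (ht i).2]
      _ = _ := by rw [← Finset.sum_mul, hc, one_mul]
  have hne := ZSpan.measure_fundamentalDomain_ne_zero b (μ := volume)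
  have hfin : volume (ZSpan.fundamentalDomain b) ≠ ⊤ := (ZSpan.fundamentalDomain_isBounded b).measure_lt_top.ne
  exact (ENNReal.toReal_pos hne hfin).ne h0

open Module MeasureTheory Convolution in
theorem aux_smooth {ι : Type*} [Fintype ι] (b : Basis ι ℝ (ι → ℝ))
    (ρ : (ι → ℝ) → ℝ) (K : NNReal) (hρ : LipschitzWith K ρ) (hb : ∀ i x, ρ (x + b i) = ρ x)
    (a : ℝ) (ha : 0 < a) :
    ∃ θ : (ι → ℝ) → ℝ, ContDiff ℝ 1 θ ∧ (∀ i x, θ (x + b i) = θ x) ∧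
      (∀ x, ρ x ≤ 0 → ∀ᶠ z in nhds x, θ z = 0) ∧ (∀ x, a ≤ ρ x → ∀ᶠ z in nhds x, θ z = 1) := by
  let h : (ι → ℝ) → ℝ := fun x => min 1 (max 0 (4 * ρ x / a - 1))
  have hρc := hρ.continuous
  have hc : Continuous h := by fun_prop
  set δ : ℝ := a / (8 * (K + 1)) with hδ
  have hKpos : (0 : ℝ) < K + 1 := by positivity
  have hδpos : 0 < δ := by positivity
  have hKδ : K * δ < a / 8 := by
    rw [hδ, mul_div_assoc', div_lt_div_iff₀ (by positivity) (by norm_num)]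
    nlinarith
  let φ : ContDiffBump (0 : ι → ℝ) := ⟨δ / 2, δ, by positivity, by linarith⟩
  have hdist : ∀ x y, dist x y < δ → |ρ x - ρ y| < a / 8 := fun x y hxy => by
    rw [← Real.dist_eq]
    refine lt_of_le_of_lt (hρ.dist_le_mul x y) (lt_of_le_of_lt ?_ hKδ)
    exact mul_le_mul_of_nonneg_left hxy.le K.2
  have h0 : ∀ x, ρ x ≤ a / 4 → h x = 0 := fun x hx => by
    have : 4 * ρ x / a - 1 ≤ 0 := by
      rw [sub_nonpos, div_le_one ha]; linarith
    simp only [h, max_eq_left this]; norm_num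
  have h1 : ∀ x, a / 2 ≤ ρ x → h x = 1 := fun x hx => by
    have : 1 ≤ 4 * ρ x / a - 1 := by
      rw [le_sub_iff_add_le, le_div_iff₀ ha]; linarith
    have h2 : (1:ℝ) ≤ max 0 (4 * ρ x / a - 1) := le_max_of_le_right this
    simp only [h, min_eq_left h2]
  refine ⟨φ.normed volume ⋆[ContinuousLinearMap.lsmul ℝ ℝ, volume] h, ?_, ?_, ?_, ?_⟩
  · exact φ.hasCompactSupport_normed.contDiff_convolution_left _ φ.contDiff_normed hc.locallyIntegrable
  · intro i x
    simp only [convolution_def]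
    congr 1
    ext1 t
    have : h (x + b i - t) = h (x - t) := by
      simp only [h, add_sub_right_comm, hb]
    rw [this]
  · intro x hx
    filter_upwards [Metric.ball_mem_nhds x hδpos] with z hz
    have hz1 := abs_lt.1 (hdist z x hz)
    have hz0 : h z = 0 := h0 z (by linarith)
    rw [φ.normed_convolution_eq_right, hz0]
    intro y hy
    have hy1 := abs_lt.1 (hdist y z hy)
    rw [hz0, h0 y (by linarith)]
  · intro x hx
    filter_upwards [Metric.ball_mem_nhds x hδpos] with z hz
    have hz1 := abs_lt.1 (hdist z x hz)
    have hz0 : h z = 1 := h1 z (by linarith)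
    rw [φ.normed_convolution_eq_right, hz0]
    intro y hy
    have hy1 := abs_lt.1 (hdist y z hy)
    rw [hz0, h1 y (by linarith)]

/-- Iterated interpolated projections. -/
noncomputable def auxIter {ι : Type*} (θ : ℕ → (ι → ℝ) → ℝ)
    (Q : ℕ → (ι → ℝ) → (ι → ℝ) → (ι → ℝ)) : ℕ → (ι → ℝ) → (ι → ℝ)
  | 0 => fun x => x
  | d + 1 => fun x => auxIter θ Q d x + θ d x • (Q d x (auxIter θ Q d x) - auxIter θ Q d x)

open Module in
theorem aux_topological {ι : Type*} [Fintype ι] (b : Basis ι ℝ (ι → ℝ)) (n : ℕ)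
    (hn : n < Fintype.card ι)
    (θ : ℕ → (ι → ℝ) → ℝ) (Q : ℕ → (ι → ℝ) → (ι → ℝ) → (ι → ℝ))
    (hθ : ∀ d < n, ContDiff ℝ 1 (θ d))
    (hθb : ∀ d < n, ∀ i x, θ d (x + b i) = θ d x)
    (hQb : ∀ d < n, ∀ i x y, Q d (x + b i) (y + b i) = Q d x y + b i)
    (hloc : ∀ d < n, ∀ x, (∀ᶠ z in nhds x, θ d z = 0) ∨
      ∃ (P : (ι → ℝ) →L[ℝ] (ι → ℝ)) (o : ι → ℝ), (∀ᶠ z in nhds x, ∀ y, Q d z y = P y + o) ∧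
        finrank ℝ (LinearMap.range (P : (ι → ℝ) →ₗ[ℝ] (ι → ℝ))) ≤ d + 1)
    (hone : ∀ x, ∃ d < n, ∀ᶠ z in nhds x, θ d z = 1) : False := by
  -- equivariance
  have heq : ∀ d ≤ n, ∀ i x, auxIter θ Q d (x + b i) = auxIter θ Q d x + b i := by
    intro d
    induction d with
    | zero => intro _ i x; rfl
    | succ d ih =>
      intro hd i x
      simp only [auxIter, ih (by omega), hθb d (by omega), hQb d (by omega)]
      rw [add_sub_add_right_eq_sub]; abel
  have hcd : ∀ d ≤ n, ContDiff ℝ 1 (auxIter θ Q d) := by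
    intro d
    induction d with
    | zero => intro _; exact contDiff_id
    | succ d ih =>
      intro hd
      have ih' := ih (by omega)
      rw [contDiff_iff_contDiffAt]
      intro x
      rcases hloc d (by omega) x with h | ⟨P, o, h, -⟩
      · refine ih'.contDiffAt.congr_of_eventuallyEq ?_
        filter_upwards [h] with z hz
        simp [auxIter, hz]
      · have : ContDiff ℝ 1 (fun z => auxIter θ Q d z + θ d z • (P (auxIter θ Q d z) + o - auxIter θ Q d z)) := by
          have := hθ d (by omega)
          fun_prop
        refine this.contDiffAt.congr_of_eventuallyEq ?_
        filter_upwards [h] with z hz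
        simp [auxIter, hz]
  -- rank bound
  have hrank : ∀ x, finrank ℝ (LinearMap.range (fderiv ℝ (auxIter θ Q n) x : (ι → ℝ) →ₗ[ℝ] (ι → ℝ))) ≤ n := by
    intro x
    obtain ⟨d, hd, h1⟩ := hone x
    suffices H : ∀ j, d + 1 ≤ j → j ≤ n →
        finrank ℝ (LinearMap.range (fderiv ℝ (auxIter θ Q j) x : (ι → ℝ) →ₗ[ℝ] (ι → ℝ))) ≤ j from
      H n hd le_rfl
    have hdiff : ∀ j ≤ n, DifferentiableAt ℝ (auxIter θ Q j) x := fun j hj =>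
      ((hcd j hj).differentiable (by norm_num)) x
    intro j hj
    induction j, hj using Nat.le_induction with
    | base =>
      intro _
      rcases hloc d hd x with h | ⟨P, o, h, hP⟩
      · exfalso
        have := (h.and h1).self_of_nhds
        rw [this.1] at this
        exact zero_ne_one this.2
      · have : fderiv ℝ (auxIter θ Q (d+1)) x = P.comp (fderiv ℝ (auxIter θ Q d) x) := by
          have h2 : auxIter θ Q (d+1) =ᶠ[nhds x] fun z => P (auxIter θ Q d z) + o := by
            filter_upwards [h, h1] with z hz hz1
            simp [auxIter, hz, hz1]
          rw [h2.fderiv_eq]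
          exact ((P.hasFDerivAt.comp x (hdiff d hd.le).hasFDerivAt).add_const o).fderiv
        rw [this]
        refine le_trans (Submodule.finrank_mono ?_) hP
        exact LinearMap.range_comp_le_range _ _
    | succ j hj ih =>
      intro hjn
      have ih' := ih (by omega)
      rcases hloc j (by omega) x with h | ⟨P, o, h, -⟩
      · have h2 : auxIter θ Q (j+1) =ᶠ[nhds x] auxIter θ Q j := by
          filter_upwards [h] with z hz
          simp [auxIter, hz]
        rw [h2.fderiv_eq]; omega
      · set A := fderiv ℝ (auxIter θ Q j) x with hA
        have hAd : HasFDerivAt (auxIter θ Q j) A x := (hdiff j (by omega)).hasFDerivAt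
        have hθd : HasFDerivAt (θ j) (fderiv ℝ (θ j) x) x :=
          (((hθ j (by omega)).differentiable (by norm_num)) x).hasFDerivAt
        have h2 : auxIter θ Q (j+1) =ᶠ[nhds x] fun z => auxIter θ Q j z + θ j z • (P (auxIter θ Q j z) + o - auxIter θ Q j z) := by
          filter_upwards [h] with z hz
          simp [auxIter, hz]
        have h3 := hAd.add (hθd.smul (((P.hasFDerivAt.comp x hAd).add_const o).sub hAd))
        rw [h2.fderiv_eq]
        erw [h3.fderiv]
        set v := P (auxIter θ Q j x) + o - auxIter θ Q j x with hv
        refine le_trans (Submodule.finrank_mono (t := Submodule.map ((ContinuousLinearMap.id ℝ (ι → ℝ) + θ j x • (P - ContinuousLinearMap.id ℝ (ι → ℝ)) : (ι → ℝ) →L[ℝ] (ι → ℝ)) : (ι → ℝ) →ₗ[ℝ] (ι → ℝ)) (LinearMap.range (A : (ι → ℝ) →ₗ[ℝ] (ι → ℝ))) ⊔ Submodule.span ℝ {v}) ?_) ?_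
        · rintro _ ⟨w, rfl⟩
          refine Submodule.mem_sup.2 ⟨A w + θ j x • (P (A w) - A w), ⟨A w, ⟨w, rfl⟩, by simp⟩, fderiv ℝ (θ j) x w • v, Submodule.smul_mem _ _ (Submodule.mem_span_singleton_self v), ?_⟩
          simp [hv]
          abel
        · refine le_trans (Submodule.finrank_add_le_finrank_add_finrank _ _) ?_
          have h4 := Submodule.finrank_map_le ((ContinuousLinearMap.id ℝ (ι → ℝ) + θ j x • (P - ContinuousLinearMap.id ℝ (ι → ℝ)) : (ι → ℝ) →L[ℝ] (ι → ℝ)) : (ι → ℝ) →ₗ[ℝ] (ι → ℝ)) (LinearMap.range (A : (ι → ℝ) →ₗ[ℝ] (ι → ℝ)))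
          have h5 : finrank ℝ (Submodule.span ℝ {v}) ≤ 1 := (finrank_span_le_card ({v} : Set (ι → ℝ))).trans (by simp)
          omega
  obtain ⟨x, hx⟩ := aux_degree b (auxIter θ Q n) (hcd n le_rfl) (heq n le_rfl)
  have hsurj : LinearMap.range (fderiv ℝ (auxIter θ Q n) x : (ι → ℝ) →ₗ[ℝ] (ι → ℝ)) = ⊤ := by
    have hu : IsUnit (LinearMap.det (fderiv ℝ (auxIter θ Q n) x : (ι → ℝ) →ₗ[ℝ] (ι → ℝ))) := isUnit_iff_ne_zero.2 hx
    exact (LinearMap.isUnit_iff_range_eq_top _).1 ((LinearMap.isUnit_iff_isUnit_det _).2 hu)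
  have := hrank x
  rw [hsurj, finrank_top, finrank_fintype_fun_eq_card] at this
  omega

section aux
variable {F : Type*} [Field F] [NumberField F]

/-- The quadratic form with positive weights `exp (2 x_w)`. -/
noncomputable def auxQf (x : InfinitePlace F → ℝ) (η : F) : ℝ :=
  ∑ w : InfinitePlace F, Real.exp (2 * x w) * (w η) ^ 2

theorem auxQf_pos (x : InfinitePlace F → ℝ) {η : F} (hη : η ≠ 0) : 0 < auxQf x η := by
  refine Finset.sum_pos (fun w _ => ?_) Finset.univ_nonempty
  have : 0 < w η := InfinitePlace.pos_iff.2 hη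
  positivity

theorem aux_exists_one_le {η : F} (hi : IsIntegral ℤ η) (hη : η ≠ 0) :
    ∃ w : InfinitePlace F, 1 ≤ w η := by
  by_contra! h
  obtain ⟨w⟩ : Nonempty (InfinitePlace F) := inferInstance
  have h1 := InfinitePlace.one_le_of_lt_one (w := w) (a := (⟨η, hi⟩ : 𝓞 F))
    (fun h0 => hη (congrArg (fun z : 𝓞 F => (z : F)) h0)) (fun z _ => h z)
  exact absurd h1 (not_le.2 (h w))

theorem auxQf_lower (x : InfinitePlace F → ℝ) {η : F} (hi : IsIntegral ℤ η) (hη : η ≠ 0) :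
    -(2 * ‖x‖) ≤ Real.log (auxQf x η) := by
  obtain ⟨w, hw⟩ := aux_exists_one_le hi hη
  rw [Real.le_log_iff_exp_le (auxQf_pos x hη)]
  calc Real.exp (-(2 * ‖x‖)) ≤ Real.exp (2 * x w) := by
        apply Real.exp_le_exp.2
        have := neg_le_of_abs_le ((Real.norm_eq_abs _).symm.le.trans (norm_le_pi_norm x w))
        linarith
    _ ≤ Real.exp (2 * x w) * (w η) ^ 2 := by
        apply le_mul_of_one_le_right (Real.exp_pos _).le
        nlinarith
    _ ≤ _ := Finset.single_le_sum (f := fun w : InfinitePlace F => Real.exp (2 * x w) * (w η) ^ 2)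
        (fun i _ => by positivity) (Finset.mem_univ w)

theorem auxQf_dist (x y : InfinitePlace F → ℝ) {η : F} (hη : η ≠ 0) :
    Real.log (auxQf y η) ≤ Real.log (auxQf x η) + 2 * dist x y := by
  rw [Real.log_le_iff_le_exp (auxQf_pos y hη), Real.exp_add, Real.exp_log (auxQf_pos x hη),
    auxQf, auxQf, Finset.sum_mul]
  refine Finset.sum_le_sum fun w _ => ?_
  rw [mul_right_comm, ← Real.exp_add]
  refine mul_le_mul_of_nonneg_right (Real.exp_le_exp.2 ?_) (by positivity)
  have := neg_le_of_abs_le ((Real.dist_eq _ _).symm.le.trans (dist_le_pi_dist x y w))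
  linarith

/-- span of the short integral vectors -/
noncomputable def auxS (x : InfinitePlace F → ℝ) (t : ℝ) : Submodule ℚ F :=
  Submodule.span ℚ {η : F | IsIntegral ℤ η ∧ η ≠ 0 ∧ Real.log (auxQf x η) < t}

theorem auxS_mono (x : InfinitePlace F → ℝ) {s t : ℝ} (h : s ≤ t) : auxS x s ≤ auxS x t :=
  Submodule.span_mono fun _ hη => ⟨hη.1, hη.2.1, hη.2.2.trans_le h⟩

theorem auxS_dist (x y : InfinitePlace F → ℝ) (t : ℝ) : auxS x t ≤ auxS y (t + 2 * dist x y) :=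
  Submodule.span_mono fun η hη => ⟨hη.1, hη.2.1, by
    have := auxQf_dist x y hη.2.1; linarith [hη.2.2]⟩

theorem auxS_bot (x : InfinitePlace F → ℝ) : auxS x (-(2 * ‖x‖)) = ⊥ := by
  rw [auxS, Submodule.span_eq_bot]
  intro η hη
  exact absurd (auxQf_lower x hη.1 hη.2.1) (not_le.2 hη.2.2)

theorem auxS_top (x : InfinitePlace F → ℝ) : ∃ t, auxS x t = ⊤ := by
  let B := NumberField.integralBasis F
  obtain ⟨T, hT⟩ := (Set.finite_range fun i => Real.log (auxQf x (B i))).bddAbove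
  refine ⟨T + 1, ?_⟩
  rw [eq_top_iff, ← B.span_eq]
  apply Submodule.span_mono
  rintro _ ⟨i, rfl⟩
  refine ⟨?_, B.ne_zero i, ?_⟩
  · rw [NumberField.integralBasis_apply]
    exact RingOfIntegers.isIntegral_coe _
  · have := hT ⟨i, rfl⟩
    simp only at this ⊢
    linarith

/-- logarithmic successive minima -/
noncomputable def auxLam (d : ℕ) (x : InfinitePlace F → ℝ) : ℝ :=
  sInf {t | d ≤ Module.finrank ℚ (auxS x t)}

theorem auxLam_nonempty {d : ℕ} (hd : d ≤ Module.finrank ℚ F) (x : InfinitePlace F → ℝ) :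
    {t | d ≤ Module.finrank ℚ (auxS x t)}.Nonempty := by
  obtain ⟨t, ht⟩ := auxS_top x
  refine ⟨t, ?_⟩
  show d ≤ Module.finrank ℚ (auxS x t)
  rw [ht, finrank_top]
  exact hd

theorem auxLam_lower {d : ℕ} (hd : 1 ≤ d) (x : InfinitePlace F → ℝ) :
    -(2 * ‖x‖) ∈ lowerBounds {t | d ≤ Module.finrank ℚ (auxS x t)} := by
  intro t ht
  by_contra! h
  have h1 : auxS x t = ⊥ := by
    rw [eq_bot_iff, ← auxS_bot x]; exact auxS_mono x h.le
  have ht' : d ≤ Module.finrank ℚ (auxS x t) := ht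
  rw [h1, finrank_bot] at ht'
  omega

theorem auxLam_lt {d : ℕ} (hd1 : d ≤ Module.finrank ℚ F) (x : InfinitePlace F → ℝ) {t : ℝ}
    (h : auxLam d x < t) : d ≤ Module.finrank ℚ (auxS x t) := by
  obtain ⟨s, hs, hst⟩ := exists_lt_of_csInf_lt (auxLam_nonempty hd1 x) h
  exact le_trans hs (Submodule.finrank_mono (auxS_mono x hst.le))

theorem auxLam_gt {d : ℕ} (hd : 1 ≤ d) (x : InfinitePlace F → ℝ) {t : ℝ}
    (h : t < auxLam d x) : Module.finrank ℚ (auxS x t) < d := by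
  by_contra! h1
  exact absurd (csInf_le ⟨_, auxLam_lower hd x⟩ h1) (not_le.2 h)

theorem auxLam_lip {d : ℕ} (hd : 1 ≤ d) (hd1 : d ≤ Module.finrank ℚ F) :
    LipschitzWith 2 (auxLam d : (InfinitePlace F → ℝ) → ℝ) := by
  refine LipschitzWith.of_le_add_mul 2 fun x y => ?_
  by_contra! h
  have h1 := auxLam_gt hd x h
  have h2 : ∀ t, auxLam d y < t → auxLam d x ≤ t + 2 * dist x y := by
    intro t ht
    by_contra! h3
    have h4 := auxLam_lt hd1 y ht
    have h5 := auxLam_gt hd x h3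
    rw [dist_comm] at h5
    have := Submodule.finrank_mono (auxS_dist y x t)
    omega
  have h3 := h2 ((auxLam d y + (auxLam d x - 2 * dist x y)) / 2) (by push_cast at h; linarith)
  push_cast at h
  linarith

/-- the `d`-th subspace of the filtration -/
noncomputable def auxV (d : ℕ) (x : InfinitePlace F → ℝ) : Submodule ℚ F :=
  auxS x ((auxLam d x + auxLam (d + 1) x) / 2)

theorem auxV_finrank {d : ℕ} (hd : 1 ≤ d) (hd1 : d + 1 ≤ Module.finrank ℚ F) (x : InfinitePlace F → ℝ)
    (h : auxLam d x < auxLam (d + 1) x) : Module.finrank ℚ (auxV d x) = d := by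
  have h1 := auxLam_lt (d := d) (by omega) x (t := (auxLam d x + auxLam (d + 1) x) / 2) (by linarith)
  have h2 := auxLam_gt (d := d + 1) (by omega) x (t := (auxLam d x + auxLam (d + 1) x) / 2) (by linarith)
  rw [auxV]; omega

theorem auxV_eventually {d : ℕ} (hd : 1 ≤ d) (hd1 : d + 1 ≤ Module.finrank ℚ F)
    (x : InfinitePlace F → ℝ) (h : auxLam d x < auxLam (d + 1) x) :
    ∀ᶠ y in nhds x, auxV d y = auxV d x := by
  have c1 := (auxLam_lip (F := F) hd (by omega)).continuous
  have c2 := (auxLam_lip (F := F) (d := d + 1) (by omega) hd1).continuous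
  have e1 : ∀ᶠ y in nhds x, auxLam d y < auxLam (d + 1) y :=
    (c1.tendsto x).eventually_lt (c2.tendsto x) h
  have e2 : ∀ᶠ y in nhds x, (auxLam d y + auxLam (d + 1) y) / 2 + 2 * dist y x < auxLam (d + 1) x := by
    have c3 : Continuous fun y => (auxLam d y + auxLam (d + 1) y) / 2 + 2 * dist y x := by fun_prop
    refine (c3.tendsto x).eventually (gt_mem_nhds ?_)
    simp only [dist_self]
    linarith
  filter_upwards [e1, e2] with y h1 h2
  have hx := auxV_finrank hd hd1 x h
  have hy := auxV_finrank hd hd1 y h1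
  set t := max ((auxLam d y + auxLam (d + 1) y) / 2 + 2 * dist y x)
    ((auxLam d x + auxLam (d + 1) x) / 2) with ht
  have hlt : t < auxLam (d + 1) x := max_lt h2 (by linarith)
  have ht1 := auxLam_gt (by omega) x hlt
  have k1 : auxV d y ≤ auxS x t := (auxS_dist y x _).trans (auxS_mono x (le_max_left _ _))
  have k2 : auxV d x ≤ auxS x t := auxS_mono x (le_max_right _ _)
  rw [Submodule.eq_of_le_of_finrank_le k1 (by omega), Submodule.eq_of_le_of_finrank_le k2 (by omega)]

/-- log vector of a unit -/
noncomputable def auxEll (u : (𝓞 F)ˣ) : InfinitePlace F → ℝ := fun w => Real.log (w (u : F))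

theorem auxEll_mul (u v : (𝓞 F)ˣ) : auxEll (u * v) = auxEll u + auxEll v := by
  ext w
  have hu : w (u : F) ≠ 0 := (InfinitePlace.pos_iff.2 (Units.coe_ne_zero u)).ne'
  have hv : w (v : F) ≠ 0 := (InfinitePlace.pos_iff.2 (Units.coe_ne_zero v)).ne'
  simp [auxEll, Real.log_mul hu hv]

/-- action of units on subspaces -/
noncomputable def auxAct (u : (𝓞 F)ˣ) (V : Submodule ℚ F) : Submodule ℚ F :=
  V.map (LinearMap.mulLeft ℚ (u : F))

theorem auxAct_mul (u v : (𝓞 F)ˣ) (V : Submodule ℚ F) : auxAct (u * v) V = auxAct u (auxAct v V) := by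
  rw [auxAct, auxAct, auxAct, ← Submodule.map_comp]
  congr 1
  ext z
  simp [mul_assoc]

theorem auxAct_one (V : Submodule ℚ F) : auxAct 1 V = V := by
  simp [auxAct, LinearMap.mulLeft_one]

theorem auxAct_finrank (u : (𝓞 F)ˣ) (V : Submodule ℚ F) :
    Module.finrank ℚ (auxAct u V) = Module.finrank ℚ V := by
  rw [auxAct]
  refine (Submodule.equivMapOfInjective _ ?_ V).finrank_eq.symm
  intro a b hab
  exact mul_left_cancel₀ (Units.coe_ne_zero u) hab

theorem auxQf_shift (x : InfinitePlace F → ℝ) (u : (𝓞 F)ˣ) (c : ℝ) (η : F) :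
    auxQf (x + (auxEll u + fun _ => c)) η = Real.exp (2 * c) * auxQf x (u * η) := by
  rw [auxQf, auxQf, Finset.mul_sum]
  refine Finset.sum_congr rfl fun w _ => ?_
  have hu : 0 < w (u : F) := InfinitePlace.pos_iff.2 (Units.coe_ne_zero u)
  simp only [Pi.add_apply, auxEll, map_mul]
  rw [show 2 * (x w + (Real.log (w (u : F)) + c)) = 2 * c + 2 * x w + Real.log (w (u:F)) + Real.log (w (u:F)) by ring,
    Real.exp_add, Real.exp_add, Real.exp_add, Real.exp_log hu]
  ring

theorem auxS_shift (x : InfinitePlace F → ℝ) (u : (𝓞 F)ˣ) (c t : ℝ) :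
    auxS x t = auxAct u (auxS (x + (auxEll u + fun _ => c)) (t + 2 * c)) := by
  have key : ∀ η : F, η ≠ 0 → Real.log (auxQf (x + (auxEll u + fun _ => c)) η) =
      2 * c + Real.log (auxQf x (u * η)) := fun η hη => by
    rw [auxQf_shift, Real.log_mul (Real.exp_pos _).ne' (auxQf_pos x (mul_ne_zero (Units.coe_ne_zero u) hη)).ne',
      Real.log_exp]
  rw [auxAct, auxS, auxS, Submodule.map_span]
  congr 1
  ext η
  simp only [Set.mem_setOf_eq, Set.mem_image, LinearMap.mulLeft_apply]
  constructor
  · rintro ⟨h1, h2, h3⟩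
    have hne : ((u⁻¹ : (𝓞 F)ˣ) : F) * η ≠ 0 := mul_ne_zero (Units.coe_ne_zero _) h2
    have hu : (u : F) * (((u⁻¹ : (𝓞 F)ˣ) : F) * η) = η := by
      rw [← mul_assoc]; simp
    refine ⟨((u⁻¹ : (𝓞 F)ˣ) : F) * η, ⟨?_, hne, ?_⟩, hu⟩
    · exact (RingOfIntegers.isIntegral_coe _).mul h1
    · rw [key _ hne, hu]; linarith
  · rintro ⟨ξ, ⟨h1, h2, h3⟩, rfl⟩
    refine ⟨(RingOfIntegers.isIntegral_coe _).mul h1, mul_ne_zero (Units.coe_ne_zero _) h2, ?_⟩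
    rw [key _ h2] at h3; linarith

theorem auxLam_shift {d : ℕ} (hd : 1 ≤ d) (hd1 : d ≤ Module.finrank ℚ F)
    (x : InfinitePlace F → ℝ) (u : (𝓞 F)ˣ) (c : ℝ) :
    auxLam d (x + (auxEll u + fun _ => c)) = auxLam d x + 2 * c := by
  have key : ∀ t, Module.finrank ℚ (auxS x t) =
      Module.finrank ℚ (auxS (x + (auxEll u + fun _ => c)) (t + 2 * c)) := fun t => by
    conv_lhs => rw [auxS_shift x u c t, auxAct_finrank]
  apply le_antisymm
  · by_contra! h
    obtain ⟨s, h1, h2⟩ := exists_between h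
    have h3 := auxLam_gt hd _ h2
    have h4 := auxLam_lt hd1 x (t := s - 2 * c) (by linarith)
    rw [key, sub_add_cancel] at h4
    omega
  · by_contra! h
    obtain ⟨s, h1, h2⟩ := exists_between h
    have h3 := auxLam_lt hd1 _ h1
    have h4 := auxLam_gt hd x (t := s - 2 * c) (by linarith)
    rw [key, sub_add_cancel] at h4
    omega

theorem auxV_shift {d : ℕ} (hd : 1 ≤ d) (hd1 : d + 1 ≤ Module.finrank ℚ F)
    (x : InfinitePlace F → ℝ) (u : (𝓞 F)ˣ) (c : ℝ) :
    auxV d x = auxAct u (auxV d (x + (auxEll u + fun _ => c))) := by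
  rw [auxV, auxV, auxLam_shift hd (by omega), auxLam_shift (by omega) hd1, auxS_shift x u c]
  congr 2
  ring
end aux

section auxD
variable {F : Type*} [Field F] [NumberField F]

/-- the stabiliser algebra of a subspace -/
def auxKalg (V : Submodule ℚ F) : Subalgebra ℚ F where
  carrier := {a | ∀ v ∈ V, a * v ∈ V}
  mul_mem' {a b} ha hb v hv := by rw [mul_assoc]; exact ha _ (hb v hv)
  add_mem' {a b} ha hb v hv := by rw [add_mul]; exact V.add_mem (ha v hv) (hb v hv)
  algebraMap_mem' r v hv := by rw [← Algebra.smul_def]; exact V.smul_mem r hv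

/-- the stabiliser field of a subspace -/
noncomputable def auxK (V : Submodule ℚ F) : IntermediateField ℚ F :=
  Algebra.IsAlgebraic.toIntermediateField (auxKalg V)

theorem auxK_mem {V : Submodule ℚ F} {a : F} : a ∈ auxK V ↔ ∀ v ∈ V, a * v ∈ V := Iff.rfl

theorem auxK_finrank {V : Submodule ℚ F} (hV : V ≠ ⊥) :
    Module.finrank ℚ (auxK V) ≤ Module.finrank ℚ V := by
  obtain ⟨v, hv, hv0⟩ := Submodule.exists_mem_ne_zero_of_ne_bot hV
  let f : auxK V →ₗ[ℚ] V :=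
    { toFun := fun a => ⟨(a : F) * v, auxK_mem.1 a.2 v hv⟩
      map_add' := fun a b => by ext; simp [add_mul]
      map_smul' := fun a b => by ext; simp }
  refine LinearMap.finrank_le_finrank_of_injective (f := f) fun a b h => ?_
  have h' : (a : F) * v = (b : F) * v := congrArg (fun z : V => (z : F)) h
  exact Subtype.ext (mul_right_cancel₀ hv0 h')

/-- functions on places which factor through the places of a subfield -/
noncomputable def auxE (K : IntermediateField ℚ F) : Submodule ℝ (InfinitePlace F → ℝ) :=
  LinearMap.range (LinearMap.funLeft ℝ ℝ
    (fun w : InfinitePlace F => w.comap (algebraMap K F)))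

theorem auxE_finrank (K : IntermediateField ℚ F) :
    Module.finrank ℝ (auxE K) ≤ Module.finrank ℚ K := by
  have h1 : Module.finrank ℝ (auxE K) ≤ Module.finrank ℝ (InfinitePlace K → ℝ) :=
    LinearMap.finrank_range_le _
  have h2 := InfinitePlace.card_add_two_mul_card_eq_rank K
  have h3 := InfinitePlace.card_eq_nrRealPlaces_add_nrComplexPlaces K
  rw [Module.finrank_fintype_fun_eq_card] at h1
  omega

theorem auxE_const (K : IntermediateField ℚ F) (c : ℝ) : (fun _ => c) ∈ auxE K :=
  ⟨fun _ => c, rfl⟩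

theorem auxE_ell (K : IntermediateField ℚ F) (u : (𝓞 F)ˣ) (h : (u : F) ∈ K) : auxEll u ∈ auxE K :=
  ⟨fun v => Real.log (v ⟨(u : F), h⟩), rfl⟩

theorem auxProj_exists {X : Type*} [AddCommGroup X] [Module ℝ X] (E : Submodule ℝ X) :
    ∃ P : X →ₗ[ℝ] X, (∀ x, P x ∈ E) ∧ ∀ x ∈ E, P x = x := by
  obtain ⟨g, hg⟩ := LinearMap.exists_leftInverse_of_injective E.subtype (Submodule.ker_subtype E)
  refine ⟨E.subtype ∘ₗ g, fun x => (g x).2, fun x hx => ?_⟩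
  have := LinearMap.congr_fun hg ⟨x, hx⟩
  simp at this
  simp [this]

/-- a chosen linear projection -/
noncomputable def auxProj {X : Type*} [AddCommGroup X] [Module ℝ X] (E : Submodule ℝ X) :
    X →ₗ[ℝ] X := (auxProj_exists E).choose

theorem auxProj_mem {X : Type*} [AddCommGroup X] [Module ℝ X] (E : Submodule ℝ X) (x : X) :
    auxProj E x ∈ E := (auxProj_exists E).choose_spec.1 x

theorem auxProj_of_mem {X : Type*} [AddCommGroup X] [Module ℝ X] (E : Submodule ℝ X) {x : X}
    (h : x ∈ E) : auxProj E x = x := (auxProj_exists E).choose_spec.2 x h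

theorem auxAct_inv {u : (𝓞 F)ˣ} {V W : Submodule ℚ F} (h : V = auxAct u W) :
    W = auxAct u⁻¹ V := by
  rw [h, ← auxAct_mul, inv_mul_cancel, auxAct_one]

/-- orbits -/
def auxSetoid (F : Type*) [Field F] [NumberField F] : Setoid (Submodule ℚ F) where
  r V W := ∃ u : (𝓞 F)ˣ, V = auxAct u W
  iseqv := by
    refine ⟨fun V => ⟨1, (auxAct_one V).symm⟩, fun {V W} h => ?_, fun {U V W} h h' => ?_⟩
    · obtain ⟨u, h⟩ := h
      exact ⟨u⁻¹, auxAct_inv h⟩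
    · obtain ⟨u, h⟩ := h
      obtain ⟨v, h'⟩ := h'
      exact ⟨u * v, by rw [auxAct_mul, ← h', h]⟩

/-- orbit representative -/
noncomputable def auxRep (V : Submodule ℚ F) : Submodule ℚ F :=
  (Quotient.mk (auxSetoid F) V).out

theorem auxRep_spec (V : Submodule ℚ F) : ∃ u : (𝓞 F)ˣ, V = auxAct u (auxRep V) :=
  (auxSetoid F).symm (Quotient.mk_out (s := auxSetoid F) V)

theorem auxRep_eq {V W : Submodule ℚ F} {u : (𝓞 F)ˣ} (h : V = auxAct u W) :
    auxRep V = auxRep W := by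
  have : Quotient.mk (auxSetoid F) V = Quotient.mk (auxSetoid F) W := Quotient.sound ⟨u, h⟩
  rw [auxRep, this, auxRep]

/-- the unit moving the representative to `V` -/
noncomputable def auxU (V : Submodule ℚ F) : (𝓞 F)ˣ := (auxRep_spec V).choose

theorem auxU_spec (V : Submodule ℚ F) : V = auxAct (auxU V) (auxRep V) :=
  (auxRep_spec V).choose_spec

theorem auxK_le {V W : Submodule ℚ F} {u : (𝓞 F)ˣ} (h : V = auxAct u W) : auxK W ≤ auxK V := by
  intro a ha
  rw [auxK_mem] at ha ⊢
  subst h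
  rintro _ ⟨w, hw, rfl⟩
  refine ⟨a * w, ha w hw, ?_⟩
  simp only [LinearMap.mulLeft_apply]
  ring

theorem auxK_eq {V W : Submodule ℚ F} {u : (𝓞 F)ˣ} (h : V = auxAct u W) : auxK V = auxK W :=
  le_antisymm (auxK_le (auxAct_inv h)) (auxK_le h)

theorem auxK_of_stab {V : Submodule ℚ F} {u : (𝓞 F)ˣ} (h : V = auxAct u V) : (u : F) ∈ auxK V := by
  rw [auxK_mem]
  intro v hv
  rw [h]
  exact ⟨v, hv, rfl⟩

/-- the projection attached to `V` -/
noncomputable def auxP (V : Submodule ℚ F) : (InfinitePlace F → ℝ) →ₗ[ℝ] (InfinitePlace F → ℝ) :=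
  auxProj (auxE (auxK V))

/-- the offset attached to `V` -/
noncomputable def auxOff (V : Submodule ℚ F) : InfinitePlace F → ℝ :=
  auxP V (auxEll (auxU V)) - auxEll (auxU V)

theorem auxP_finrank {V : Submodule ℚ F} (hV : V ≠ ⊥) :
    Module.finrank ℝ (LinearMap.range (auxP V)) ≤ Module.finrank ℚ V := by
  have h1 : LinearMap.range (auxP V) ≤ auxE (auxK V) := by
    rintro _ ⟨x, rfl⟩
    exact auxProj_mem _ x
  exact (Submodule.finrank_mono h1).trans ((auxE_finrank _).trans (auxK_finrank hV))

theorem auxEll_one : auxEll (1 : (𝓞 F)ˣ) = 0 := by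
  ext w; simp [auxEll]

theorem auxEll_inv (u : (𝓞 F)ˣ) : auxEll u⁻¹ = -auxEll u := by
  have := auxEll_mul u⁻¹ u
  rw [inv_mul_cancel, auxEll_one] at this
  exact eq_neg_of_add_eq_zero_left this.symm

theorem auxQ_equiv {V W : Submodule ℚ F} {u : (𝓞 F)ˣ} (h : V = auxAct u W) (c : ℝ)
    (y : InfinitePlace F → ℝ) :
    auxP W (y + (auxEll u + fun _ => c)) + auxOff W =
      auxP V y + auxOff V + (auxEll u + fun _ => c) := by
  have hP : auxP V = auxP W := by rw [auxP, auxP, auxK_eq h]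
  have hs : V = auxAct (u * auxU W * (auxU V)⁻¹) V := by
    have h1 := auxU_spec V
    have h2 := auxU_spec W
    rw [← auxRep_eq h] at h2
    rw [auxAct_mul, auxAct_mul, ← auxAct_inv h1, ← h2, ← h]
  have hm := auxE_ell _ _ (auxK_of_stab hs)
  have hm' := auxProj_of_mem _ hm
  have hc := auxProj_of_mem _ (auxE_const (auxK V) c)
  change auxP V _ = _ at hm'
  change auxP V _ = _ at hc
  rw [auxEll_mul, auxEll_mul, auxEll_inv, map_add, map_add, map_neg] at hm'
  rw [auxOff, auxOff, ← hP, map_add, map_add, hc]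
  have e : auxP V (auxEll u) = auxEll u + auxEll (auxU W) - auxEll (auxU V)
      - auxP V (auxEll (auxU W)) + auxP V (auxEll (auxU V)) := by
    rw [sub_eq_add_neg (_ + _) (auxEll (auxU V)), ← hm']; abel
  rw [e]
  abel

open NumberField.mixedEmbedding NumberField.mixedEmbedding.fundamentalCone in
theorem auxBasis (hreal : ∀ v : InfinitePlace F, v.IsReal) :
    ∃ b : Module.Basis (InfinitePlace F) ℝ (InfinitePlace F → ℝ),
      ∀ i, ∃ (u : (𝓞 F)ˣ) (c : ℝ), b i = auxEll u + fun _ => c := by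
  have hm : ∀ w : InfinitePlace F, w.mult = 1 := fun w => by
    simp [InfinitePlace.mult, hreal w]
  refine ⟨completeBasis F, fun i => ?_⟩
  by_cases hi : i = NumberField.Units.dirichletUnitTheorem.w₀
  · refine ⟨1, 1, ?_⟩
    rw [hi, completeBasis_apply_of_eq, auxEll_one]
    ext w
    simp [hm w]
  · refine ⟨NumberField.Units.fundSystem F (equivFinRank.symm ⟨i, hi⟩), 0, ?_⟩
    rw [completeBasis_apply_of_ne F ⟨i, hi⟩]
    ext w
    rw [expMap_symm_apply, normAtAllPlaces_mixedEmbedding]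
    simp [hm w, auxEll]
end auxD

section auxE
variable {F : Type*} [Field F] [NumberField F]

theorem auxLam_mono {d e : ℕ} (hd : 1 ≤ d) (hde : d ≤ e) (he : e ≤ Module.finrank ℚ F)
    (x : InfinitePlace F → ℝ) : auxLam d x ≤ auxLam e x :=
  csInf_le_csInf ⟨_, auxLam_lower hd x⟩ (auxLam_nonempty he x) fun _ ht => le_trans hde ht

theorem aux_card (hreal : ∀ v : InfinitePlace F, v.IsReal) :
    Fintype.card (InfinitePlace F) = Module.finrank ℚ F := by
  have h1 : IsTotallyReal F := ⟨hreal⟩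
  have h2 := InfinitePlace.card_add_two_mul_card_eq_rank F
  have h3 := InfinitePlace.card_eq_nrRealPlaces_add_nrComplexPlaces F
  have h4 := IsTotallyReal.nrComplexPlaces_eq_zero F
  omega

theorem auxWellRounded (hreal : ∀ v : InfinitePlace F, v.IsReal) :
    ∃ x : InfinitePlace F → ℝ, auxLam (Module.finrank ℚ F) x ≤ auxLam 1 x := by
  obtain ⟨b, hb⟩ := auxBasis hreal
  set m := Module.finrank ℚ F with hmdef
  have hm : 1 ≤ m := Module.finrank_pos
  have hper : ∀ d, 1 ≤ d → d ≤ m → ∀ i, ∃ c : ℝ, ∀ x, auxLam d (x + b i) = auxLam d x + 2 * c ∧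
      auxLam 1 (x + b i) = auxLam 1 x + 2 * c := by
    intro d h1 h2 i
    obtain ⟨u, c, h⟩ := hb i
    exact ⟨c, fun x => by rw [h]; exact ⟨auxLam_shift h1 h2 x u c, auxLam_shift le_rfl hm x u c⟩⟩
  have hper' : ∀ d, 1 ≤ d → d ≤ m → ∀ i x, auxLam d (x + b i) - auxLam 1 (x + b i) =
      auxLam d x - auxLam 1 x := by
    intro d h1 h2 i x
    obtain ⟨c, h⟩ := hper d h1 h2 i
    rw [(h x).1, (h x).2]; ring
  obtain ⟨x₀, hx₀⟩ := aux_periodic_min b (fun x => auxLam m x - auxLam 1 x)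
    ((auxLam_lip hm le_rfl).continuous.sub (auxLam_lip le_rfl hm).continuous)
    (hper' m hm le_rfl)
  by_contra! hcon
  set ε := auxLam m x₀ - auxLam 1 x₀ with hε
  have hεp : 0 < ε := sub_pos.2 (hcon x₀)
  have hmp : (0 : ℝ) < m := by exact_mod_cast hm
  have key : ∀ d, ∃ θ : (InfinitePlace F → ℝ) → ℝ, d < m - 1 → ContDiff ℝ 1 θ ∧
      (∀ i x, θ (x + b i) = θ x) ∧
      (∀ x, auxLam (d + 2) x - auxLam (d + 1) x ≤ 0 → ∀ᶠ z in nhds x, θ z = 0) ∧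
      (∀ x, ε / m ≤ auxLam (d + 2) x - auxLam (d + 1) x → ∀ᶠ z in nhds x, θ z = 1) := by
    intro d
    by_cases hd : d < m - 1
    · obtain ⟨θ, h⟩ := aux_smooth b (fun x => auxLam (d + 2) x - auxLam (d + 1) x) _
        ((auxLam_lip (F := F) (d := d + 2) (by omega) (by omega)).sub
          (auxLam_lip (F := F) (d := d + 1) (by omega) (by omega)))
        (fun i x => by
          have h1 := hper' (d + 2) (by omega) (by omega) i x
          have h2 := hper' (d + 1) (by omega) (by omega) i x
          linarith) (ε / m) (by positivity)
      exact ⟨θ, fun _ => h⟩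
    · exact ⟨0, fun h => absurd h hd⟩
  choose θ hθ using key
  refine aux_topological b (m - 1) (by rw [aux_card hreal]; omega) θ
    (fun d x y => auxP (auxV (d + 1) x) y + auxOff (auxV (d + 1) x))
    (fun d hd => (hθ d hd).1) (fun d hd => (hθ d hd).2.1) ?_ ?_ ?_
  · intro d hd i x y
    obtain ⟨u, c, h⟩ := hb i
    rw [h]
    exact auxQ_equiv (auxV_shift (by omega) (by omega) x u c) c y
  · intro d hd x
    by_cases hx : auxLam (d + 2) x - auxLam (d + 1) x ≤ 0
    · exact Or.inl ((hθ d hd).2.2.1 x hx)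
    · right
      have hlt : auxLam (d + 1) x < auxLam (d + 1 + 1) x := by push Not at hx; linarith
      have hr := auxV_finrank (by omega) (by omega) x hlt
      refine ⟨LinearMap.toContinuousLinearMap (auxP (auxV (d + 1) x)), auxOff (auxV (d + 1) x), ?_, ?_⟩
      · filter_upwards [auxV_eventually (by omega) (by omega) x hlt] with z hz y
        rw [hz]; rfl
      · rw [LinearMap.coe_toContinuousLinearMap]
        refine (auxP_finrank ?_).trans hr.le
        intro h0
        rw [h0, finrank_bot] at hr
        omega
  · intro x
    by_contra hno
    have h1 : ∀ d ∈ Finset.range (m - 1), auxLam (d + 1 + 1) x - auxLam (d + 1) x ≤ ε / m := by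
      intro d hd
      rw [Finset.mem_range] at hd
      by_contra! h
      exact hno ⟨d, hd, (hθ d hd).2.2.2 x h.le⟩
    have h2 := Finset.sum_le_sum h1
    rw [Finset.sum_range_sub (fun d => auxLam (d + 1) x), Nat.sub_add_cancel hm] at h2
    have h3 := hx₀ x
    simp only [Finset.sum_const, Finset.card_range, nsmul_eq_mul, zero_add] at h2 h3
    rw [Nat.cast_sub hm, ← hε] at *
    have h4 : (m : ℝ) * (ε / m) = ε := by field_simp
    have h5 : 0 < ε / m := by positivity
    push_cast at h2
    nlinarith
end auxE

section auxF
variable {F : Type*} [Field F] [NumberField F]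

/-- real embeddings attached to places -/
noncomputable def auxEmb (hreal : ∀ v : InfinitePlace F, v.IsReal) (w : InfinitePlace F) : F →+* ℝ :=
  InfinitePlace.embedding_of_isReal (hreal w)

theorem auxEmb_sq (hreal : ∀ v : InfinitePlace F, v.IsReal) (w : InfinitePlace F) (η : F) :
    auxEmb hreal w η ^ 2 = w η ^ 2 := by
  rw [← InfinitePlace.norm_embedding_of_isReal (hreal w), Real.norm_eq_abs, sq_abs]
  rfl

theorem auxEmb_inj (hreal : ∀ v : InfinitePlace F, v.IsReal) :
    Function.Injective (auxEmb hreal) := by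
  intro w w' h
  ext η
  rw [← InfinitePlace.norm_embedding_of_isReal (hreal w),
    ← InfinitePlace.norm_embedding_of_isReal (hreal w')]
  exact congrArg (fun f : F →+* ℝ => ‖f η‖) h

theorem auxEmb_embedding (hreal : ∀ v : InfinitePlace F, v.IsReal) (φ : F →+* ℂ) :
    (InfinitePlace.mk φ).embedding = φ :=
  InfinitePlace.embedding_mk_eq_of_isReal (InfinitePlace.isReal_mk_iff.1 (hreal _))

theorem auxEmb_surj (hreal : ∀ v : InfinitePlace F, v.IsReal) (σ : F →+* ℝ) :
    ∃ w, auxEmb hreal w = σ := by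
  refine ⟨InfinitePlace.mk (Complex.ofRealHom.comp σ), ?_⟩
  ext η
  apply Complex.ofReal_injective
  rw [auxEmb, InfinitePlace.embedding_of_isReal_apply, auxEmb_embedding hreal]
  rfl

theorem auxTrace (hreal : ∀ v : InfinitePlace F, v.IsReal) (β : F) :
    ((Algebra.trace ℚ F β : ℚ) : ℝ) = ∑ w, auxEmb hreal w β := by
  apply Complex.ofReal_injective
  have h := trace_eq_sum_embeddings (K := ℚ) (L := F) ℂ (x := β)
  have h2 : ∑ σ : F →ₐ[ℚ] ℂ, σ β = ∑ w : InfinitePlace F, w.embedding β := by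
    symm
    refine Fintype.sum_bijective (fun w : InfinitePlace F => w.embedding.toRatAlgHom) ⟨?_, ?_⟩ _ _
      (fun w => rfl)
    · intro w w' h
      apply InfinitePlace.embedding_injective
      ext η
      exact DFunLike.congr_fun h η
    · intro σ
      refine ⟨InfinitePlace.mk (σ : F →+* ℂ), ?_⟩
      ext η
      simp [auxEmb_embedding hreal]
  rw [h2] at h
  simp only [auxEmb, Complex.ofReal_sum, InfinitePlace.embedding_of_isReal_apply]
  rw [← h]
  simp

theorem auxTrace_form (hreal : ∀ v : InfinitePlace F, v.IsReal) (α η : F) :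
    ((Algebra.trace ℚ F (α * η * η) : ℚ) : ℝ) = ∑ w, auxEmb hreal w α * (w η) ^ 2 := by
  rw [auxTrace hreal]
  refine Finset.sum_congr rfl fun w _ => ?_
  rw [← auxEmb_sq hreal]
  simp only [map_mul]
  ring

theorem auxFinite (x : InfinitePlace F → ℝ) (T : ℝ) :
    {η : F | IsIntegral ℤ η ∧ auxQf x η ≤ T}.Finite := by
  refine (NumberField.Embeddings.finite_of_norm_le F ℂ (1 + T * Real.exp (2 * ‖x‖))).subset ?_
  rintro η ⟨h1, h2⟩
  refine ⟨h1, fun φ => ?_⟩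
  change InfinitePlace.mk φ η ≤ _
  set w := InfinitePlace.mk φ
  have h3 : Real.exp (2 * x w) * (w η) ^ 2 ≤ T := le_trans
    (Finset.single_le_sum (f := fun w : InfinitePlace F => Real.exp (2 * x w) * (w η) ^ 2)
        (fun i _ => by positivity) (Finset.mem_univ w)) h2
  have h4 : 1 ≤ Real.exp (2 * ‖x‖) * Real.exp (2 * x w) := by
    rw [← Real.exp_add]
    apply Real.one_le_exp
    have := neg_le_of_abs_le ((Real.norm_eq_abs _).symm.le.trans (norm_le_pi_norm x w))
    linarith
  have h5 : (w η) ^ 2 ≤ T * Real.exp (2 * ‖x‖) := by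
    calc (w η) ^ 2 ≤ (Real.exp (2 * ‖x‖) * Real.exp (2 * x w)) * (w η) ^ 2 :=
          le_mul_of_one_le_left (by positivity) h4
      _ = (Real.exp (2 * x w) * (w η) ^ 2) * Real.exp (2 * ‖x‖) := by ring
      _ ≤ _ := mul_le_mul_of_nonneg_right h3 (Real.exp_pos _).le
  nlinarith [sq_nonneg (w η - 1)]

theorem auxMinVecs (hreal : ∀ v : InfinitePlace F, v.IsReal) :
    ∃ (x : InfinitePlace F → ℝ) (μ μ' : ℝ), 0 < μ ∧ μ < μ' ∧
      Submodule.span ℚ {η : F | IsIntegral ℤ η ∧ η ≠ 0 ∧ auxQf x η = μ} = ⊤ ∧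
      ∀ η : F, IsIntegral ℤ η → η ≠ 0 → auxQf x η ≠ μ → μ' ≤ auxQf x η := by
  obtain ⟨x, hx⟩ := auxWellRounded hreal
  have hm : 1 ≤ Module.finrank ℚ F := Module.finrank_pos
  set L := auxLam 1 x with hL
  have hlow : ∀ η : F, IsIntegral ℤ η → η ≠ 0 → L ≤ Real.log (auxQf x η) := by
    intro η h1 h2
    by_contra! h
    obtain ⟨t, ht1, ht2⟩ := exists_between h
    have h3 := auxLam_gt le_rfl x ht2
    have h4 : auxS x t = ⊥ := Submodule.finrank_eq_zero.1 (by omega)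
    have h5 : η ∈ auxS x t := Submodule.subset_span ⟨h1, h2, ht1⟩
    rw [h4, Submodule.mem_bot] at h5
    exact h2 h5
  have hgap : ∃ t, L < t ∧ ∀ η : F, IsIntegral ℤ η → η ≠ 0 → Real.log (auxQf x η) < t →
      Real.log (auxQf x η) = L := by
    have hf := (auxFinite x (Real.exp (L + 1))).image (fun η => Real.log (auxQf x η))
    have hf' : ∀ᶠ t in nhdsWithin L (Set.Ioi L), ∀ v ∈ (fun η => Real.log (auxQf x η)) ''
        {η : F | IsIntegral ℤ η ∧ auxQf x η ≤ Real.exp (L + 1)}, L < v → t < v := by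
      rw [Filter.eventually_all_finite hf]
      intro v _
      by_cases hv : L < v
      · filter_upwards [mem_nhdsWithin_of_mem_nhds (gt_mem_nhds hv)] with t ht _
        exact ht
      · exact Filter.Eventually.of_forall fun _ h => absurd h hv
    have h1 : ∀ᶠ t in nhdsWithin L (Set.Ioi L), t < L + 1 :=
      mem_nhdsWithin_of_mem_nhds (gt_mem_nhds (by linarith))
    have h2 : ∀ᶠ t in nhdsWithin L (Set.Ioi L), L < t := self_mem_nhdsWithin
    obtain ⟨t, h3, h4, h5⟩ := (hf'.and (h1.and h2)).exists
    refine ⟨t, h5, fun η hi h0 hlt => ?_⟩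
    by_contra hne
    have h6 : L < Real.log (auxQf x η) := lt_of_le_of_ne (hlow η hi h0) (Ne.symm hne)
    have h7 := h3 _ ⟨η, ⟨hi, ?_⟩, rfl⟩ h6
    · simp only at h7; linarith
    · rw [← Real.log_le_iff_le_exp (auxQf_pos x h0)]; linarith
  obtain ⟨t, htL, ht⟩ := hgap
  refine ⟨x, Real.exp L, Real.exp t, Real.exp_pos _, Real.exp_lt_exp.2 htL, ?_, ?_⟩
  · have h1 := auxLam_lt le_rfl x (hx.trans_lt htL)
    have h2 : auxS x t = ⊤ := Submodule.eq_top_of_finrank_eq (le_antisymm (Submodule.finrank_le _) h1)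
    rw [eq_top_iff, ← h2]
    apply Submodule.span_mono
    rintro η ⟨hi, h0, hlt⟩
    refine ⟨hi, h0, ?_⟩
    rw [← ht η hi h0 hlt, Real.exp_log (auxQf_pos x h0)]
  · intro η hi h0 hne
    by_contra! hlt
    apply hne
    have : Real.log (auxQf x η) < t := by rwa [Real.log_lt_iff_lt_exp (auxQf_pos x h0)]
    rw [← ht η hi h0 this, Real.exp_log (auxQf_pos x h0)]

/-- all real embeddings, as a linear map -/
noncomputable def auxSl (hreal : ∀ v : InfinitePlace F, v.IsReal) : F →ₗ[ℚ] (InfinitePlace F → ℝ) :=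
  LinearMap.pi fun w => (auxEmb hreal w).toRatAlgHom.toLinearMap

theorem auxSl_apply (hreal : ∀ v : InfinitePlace F, v.IsReal) (β : F) (w : InfinitePlace F) :
    auxSl hreal β w = auxEmb hreal w β := rfl

theorem auxSl_span (hreal : ∀ v : InfinitePlace F, v.IsReal) :
    Submodule.span ℝ (Set.range (auxSl hreal)) = ⊤ := by
  classical
  by_contra hne
  obtain ⟨f, hf0, hf⟩ := Submodule.exists_le_ker_of_lt_top _ (lt_top_iff_ne_top.2 hne)
  have hli := (linearIndependent_monoidHom F ℝ).comp
    (fun w : InfinitePlace F => ((auxEmb hreal w : F →+* ℝ) : F →* ℝ)) (by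
      intro w w' h
      apply auxEmb_inj hreal
      ext η
      exact DFunLike.congr_fun h η)
  rw [Fintype.linearIndependent_iff] at hli
  apply hf0
  have hz := hli (fun w => f (Pi.single w 1)) (by
    ext β
    have h1 : f (auxSl hreal β) = 0 := hf (Submodule.subset_span ⟨β, rfl⟩)
    rw [LinearMap.pi_apply_eq_sum_univ f] at h1
    simp only [Finset.sum_apply, Pi.smul_apply, Function.comp_apply, smul_eq_mul, Pi.zero_apply]
    rw [← h1]
    refine Finset.sum_congr rfl fun w _ => ?_
    rw [smul_eq_mul, mul_comm, auxSl_apply]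
    congr 2
    ext j
    simp [Pi.single_apply, eq_comm])
  apply LinearMap.pi_ext'
  intro w
  ext
  simpa using hz w

theorem auxRational (hreal : ∀ v : InfinitePlace F, v.IsReal) (a : InfinitePlace F → ℝ) :
    ∃ (k : ℕ) (e : Fin k → ℝ) (β : Fin k → F), LinearIndependent ℚ e ∧
      ∀ w, a w = ∑ j, e j * auxEmb hreal w (β j) := by
  have ha : a ∈ Submodule.span ℝ (Set.range (auxSl hreal)) := by rw [auxSl_span]; trivial
  rw [Submodule.mem_span_set'] at ha
  obtain ⟨n, c, g, hg⟩ := ha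
  choose ω hω using fun i => (g i).2
  let U : Submodule ℚ ℝ := Submodule.span ℚ (Set.range c)
  have : FiniteDimensional ℚ U := FiniteDimensional.span_of_finite ℚ (Set.finite_range c)
  let B := Module.finBasis ℚ U
  let c' : Fin n → U := fun i => ⟨c i, Submodule.subset_span ⟨i, rfl⟩⟩
  refine ⟨_, fun j => (B j : ℝ), fun j => ∑ i, B.repr (c' i) j • ω i, ?_, fun w => ?_⟩
  · exact B.linearIndependent.map' U.subtype (Submodule.ker_subtype U)
  · have h1 : ∀ i, c i = ∑ j, (B.repr (c' i) j : ℝ) * (B j : ℝ) := fun i => by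
      have := congrArg (fun z : U => (z : ℝ)) (B.sum_repr (c' i))
      simp only [AddSubmonoidClass.coe_finsetSum, Submodule.coe_smul, Rat.smul_def] at this
      exact this.symm
    have h2 : a w = ∑ i, c i * auxEmb hreal w (ω i) := by
      rw [← hg]
      simp only [Finset.sum_apply, Pi.smul_apply, smul_eq_mul, ← hω, auxSl_apply]
    rw [h2]
    simp only [map_sum, Finset.mul_sum, Rat.smul_def, map_mul, map_ratCast]
    rw [Finset.sum_comm]
    refine Finset.sum_congr rfl fun i _ => ?_
    rw [h1 i, Finset.sum_mul]
    refine Finset.sum_congr rfl fun j _ => ?_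
    ring
end auxF

/-- Let `F` be a totally real number field of degree `m`.  Then there exists a totally
positive `α ∈ F` such that the set of minimal vectors of the scaled trace form `φ_α`
contains `m` elements of `𝓞 F` that are linearly independent over `ℚ`. -/
theorem exists_totallyPositive_scaledTraceForm_linearIndependent_minVecs
    (F : Type*) [Field F] [NumberField F] (m : ℕ)
    (hdeg : Module.finrank ℚ F = m)
    (hreal : ∀ v : InfinitePlace F, v.IsReal) :
    ∃ α : F, (∀ σ : F →+* ℝ, 0 < σ α) ∧
      ∃ η : Fin m → RingOfIntegers F,
        (∀ i, IsMinVec F α (η i)) ∧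
        LinearIndependent ℚ (fun i => ((η i : F))) := by
  obtain ⟨x, μ, μ', hμ, hμμ', hspan, hgap⟩ := auxMinVecs hreal
  obtain ⟨k, e, β, hli, ha⟩ := auxRational hreal (fun w => Real.exp (2 * x w))
  -- the form of each basis element
  set T : Fin k → F → ℚ := fun j η => Algebra.trace ℚ F (β j * η * η) with hT
  have hqf : ∀ η, auxQf x η = ∑ j, e j * (T j η : ℝ) := by
    intro η
    simp only [hT, auxTrace_form hreal, auxQf, Finset.mul_sum]
    rw [Finset.sum_comm]
    refine Finset.sum_congr rfl fun w _ => ?_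
    rw [ha w, Finset.sum_mul]
    exact Finset.sum_congr rfl fun j _ => by ring
  -- the form attached to rational coefficients
  have hform : ∀ (e' : Fin k → ℚ) (η : F),
      Algebra.trace ℚ F ((∑ j, e' j • β j) * η * η) = ∑ j, e' j * T j η := by
    intro e' η
    simp only [Finset.sum_mul, map_sum, smul_mul_assoc, map_smul, smul_eq_mul, hT]
  have hTeq : ∀ η η' : F, auxQf x η = μ → auxQf x η' = μ → ∀ j, T j η = T j η' := by
    intro η η' h h' j
    rw [Fintype.linearIndependent_iff] at hli
    refine sub_eq_zero.1 (hli (fun j => T j η - T j η') ?_ j)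
    rw [hqf] at h h'
    calc ∑ j, (T j η - T j η') • e j = (∑ j, e j * (T j η : ℝ)) - ∑ j, e j * (T j η' : ℝ) := by
          rw [← Finset.sum_sub_distrib]
          refine Finset.sum_congr rfl fun j _ => ?_
          rw [Rat.smul_def]; push_cast; ring
      _ = 0 := by rw [h, h', sub_self]
  -- approximate
  obtain ⟨δ, hδ0, hδ1, hδ⟩ : ∃ δ : ℝ, 0 < δ ∧ δ < 1 ∧ (1 + δ) * μ ≤ (1 - δ) * μ' := by
    refine ⟨(μ' - μ) / (μ' + μ), div_pos (by linarith) (by linarith), ?_, ?_⟩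
    · rw [div_lt_one (by linarith)]; linarith
    · have : μ' + μ ≠ 0 := by linarith
      apply le_of_eq
      field_simp
      ring
  obtain ⟨e', he'⟩ : ∃ e' : Fin k → ℚ, ∀ w,
      (1 - δ) * Real.exp (2 * x w) < auxEmb hreal w (∑ j, e' j • β j) ∧
      auxEmb hreal w (∑ j, e' j • β j) < (1 + δ) * Real.exp (2 * x w) := by
    have hd : DenseRange (Pi.map fun (_ : Fin k) (q : ℚ) => (q : ℝ)) :=
      DenseRange.piMap fun _ => Rat.denseRange_cast
    have hO : IsOpen {f : Fin k → ℝ | ∀ w,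
        (1 - δ) * Real.exp (2 * x w) < ∑ j, f j * auxEmb hreal w (β j) ∧
        ∑ j, f j * auxEmb hreal w (β j) < (1 + δ) * Real.exp (2 * x w)} := by
      rw [Set.setOf_forall]
      refine isOpen_iInter_of_finite fun w => ?_
      have hc : Continuous fun f : Fin k → ℝ => ∑ j, f j * auxEmb hreal w (β j) := by fun_prop
      exact (isOpen_lt continuous_const hc).inter (isOpen_lt hc continuous_const)
    obtain ⟨e', he'⟩ := hd.exists_mem_open hO ⟨e, fun w => by
      have := Real.exp_pos (2 * x w)
      rw [← ha w]
      constructor <;> nlinarith⟩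
    refine ⟨e', fun w => ?_⟩
    have h := he' w
    simpa only [map_sum, Rat.smul_def, map_mul, map_ratCast, Pi.map_apply] using h
  set α := ∑ j, e' j • β j with hα
  have hlower : ∀ η : F, (1 - δ) * auxQf x η ≤ ((Algebra.trace ℚ F (α * η * η) : ℚ) : ℝ) := by
    intro η
    rw [auxTrace_form hreal, auxQf, Finset.mul_sum]
    refine Finset.sum_le_sum fun w _ => ?_
    rw [← mul_assoc]
    exact mul_le_mul_of_nonneg_right (he' w).1.le (by positivity)
  have hupper : ∀ η : F, ((Algebra.trace ℚ F (α * η * η) : ℚ) : ℝ) ≤ (1 + δ) * auxQf x η := by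
    intro η
    rw [auxTrace_form hreal, auxQf, Finset.mul_sum]
    refine Finset.sum_le_sum fun w _ => ?_
    rw [← mul_assoc]
    exact mul_le_mul_of_nonneg_right (he' w).2.le (by positivity)
  have hmin : ∀ η : RingOfIntegers F, (η : F) ≠ 0 → auxQf x (η : F) = μ → IsMinVec F α η := by
    intro η h0 hq
    refine ⟨fun h => h0 (by rw [h]; rfl), fun ξ hξ => ?_⟩
    have hξ0 : (ξ : F) ≠ 0 := RingOfIntegers.coe_ne_zero_iff.2 hξ
    rw [scaledTraceForm, scaledTraceForm]
    by_cases hξq : auxQf x (ξ : F) = μ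
    · rw [hform, hform]
      refine le_of_eq (Finset.sum_congr rfl fun j _ => ?_)
      rw [hTeq _ _ hq hξq j]
    · have h1 := hgap ξ (RingOfIntegers.isIntegral_coe ξ) hξ0 hξq
      have h2 := hlower (ξ : F)
      have h3 := hupper (η : F)
      rw [hq] at h3
      have h4 : (1 - δ) * μ' ≤ (1 - δ) * auxQf x (ξ : F) :=
        mul_le_mul_of_nonneg_left h1 (by linarith)
      have h5 : ((Algebra.trace ℚ F (α * η * η) : ℚ) : ℝ) ≤
        ((Algebra.trace ℚ F (α * ξ * ξ) : ℚ) : ℝ) := by linarith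
      exact_mod_cast h5
  refine ⟨α, fun σ => ?_, ?_⟩
  · obtain ⟨w, rfl⟩ := auxEmb_surj hreal σ
    refine lt_trans ?_ (he' w).1
    have := Real.exp_pos (2 * x w)
    have : 0 < 1 - δ := by linarith
    positivity
  · obtain ⟨s, hs1, hs2, hs3⟩ := exists_linearIndependent ℚ
      {η : F | IsIntegral ℤ η ∧ η ≠ 0 ∧ auxQf x η = μ}
    rw [hspan] at hs2
    let B : Module.Basis s ℚ F := Module.Basis.mk hs3 (by rw [Subtype.range_coe, hs2])
    let E : Fin m ≃ s := (Module.finBasisOfFinrankEq ℚ F hdeg).indexEquiv B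
    refine ⟨fun i => ⟨(E i : F), (hs1 (E i).2).1⟩, fun i => ?_, ?_⟩
    · exact hmin _ (hs1 (E i).2).2.1 (hs1 (E i).2).2.2
    · exact hs3.comp E E.injective
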